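/- For every natural number k, X_{2k+3} = r·X_{k+1}² + X_{k+2}·(p·X_{k+2} + 2·q·X_{k+1} + 2·r·X_k). -/

import Mathlib

/-- Addition formula for the fundamental solution of a third-order linear recurrence. -/
theorem third_order_recurrence_add {R : Type*} [CommRing R] (p q r : R) (X : ℕ → R)
    (hX0 : X 0 = 0) (hX1 : X 1 = 0) (hX2 : X 2 = 1)
    (hXrec : ∀ k, X (k + 3) = p * X (k + 2) + q * X (k + 1) + r * X k) (n m : ℕ) :
    X (m + n + 2) = X (n + 2) * X (m + 2) + (q * X (n + 1) + r * X n) * X (m + 1)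
      + r * X (n + 1) * X m := by
  induction n generalizing m with
  | zero => simp [hX0, hX1, hX2]
  | succ n ih =>
    have h := ih (m + 1)
    rw [show m + 1 + n + 2 = m + (n + 1) + 2 by ring] at h
    rw [h, show m + 1 + 2 = m + 3 from rfl, show n + 1 + 2 = n + 3 from rfl, hXrec m, hXrec n]
    ring

theorem stmt_15 (p q r : ℤ) (X : ℕ → ℤ)
    (hX0 : X 0 = 0) (hX1 : X 1 = 0) (hX2 : X 2 = 1)
    (hXrec : ∀ k, X (k + 3) = p * X (k + 2) + q * X (k + 1) + r * X k) :
    ∀ k : ℕ, X (2 * k + 3) = r * X (k + 1) ^ 2 + X (k + 2) * (p * X (k + 2) + 2 * q * X (k + 1) + 2 * r * X k) := by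
  intro k
  have h := third_order_recurrence_add p q r X hX0 hX1 hX2 hXrec k (k + 1)
  rw [show k + 1 + k + 2 = 2 * k + 3 by ring] at h
  rw [h, show k + 1 + 2 = k + 3 from rfl, hXrec k]
  ring
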